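/- Under Assumption 2, let H be any n×n row-stochastic matrix with H i i > 0 for all i ∈ V, and set Φ = H·Ψ. Then: (a) for every i ∈ V and every stubborn j (ξⱼ < 1), H i j > 0 implies Φ i j > 0; (b) for every partially stubborn i (0 < ξᵢ < 1) and every stubborn j (ξⱼ < 1) with j ≠ i, W i j > 0 implies Φ i j > 0. -/

import Mathlib

open Matrix Filter Finset

/-- `S` is an independent strongly connected component of the influence graph `G(W)`
(edge from `j` to `i` iff `W i j ≠ 0`): nonempty, in-closed and strongly connected. -/
def IsISCC {n : ℕ} (W : Matrix (Fin n) (Fin n) ℝ) (S : Set (Fin n)) : Prop :=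
  S.Nonempty ∧ (∀ i ∈ S, ∀ j, W i j ≠ 0 → j ∈ S) ∧
    (∀ i ∈ S, ∀ j ∈ S, i ≠ j → ∃ m, 1 ≤ m ∧ 0 < (W ^ m) i j)

/-- Assumption 2: every ISCC of `G(W)` contains at least one stubborn agent. -/
def Assumption2 {n : ℕ} (W : Matrix (Fin n) (Fin n) ℝ) (ξ : Fin n → ℝ) : Prop :=
  ∀ S : Set (Fin n), IsISCC W S → ∃ i ∈ S, ξ i < 1

/-- Every nonempty in-closed set of agents contains an independent strongly connected component. -/
theorem exists_isISCC_subset {n : ℕ} {W : Matrix (Fin n) (Fin n) ℝ}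
    (hW0 : ∀ i j, 0 ≤ W i j) (hW1 : ∀ i, ∑ j, W i j = 1) {S : Set (Fin n)}
    (hS : S.Nonempty) (hcl : ∀ i ∈ S, ∀ j, W i j ≠ 0 → j ∈ S) :
    ∃ T ⊆ S, IsISCC W T := by
  obtain ⟨T, hTS, hT⟩ := exists_minimal_le_of_wellFoundedLT
    (fun T : Set (Fin n) => T.Nonempty ∧ ∀ i ∈ T, ∀ j, W i j ≠ 0 → j ∈ T) S ⟨hS, hcl⟩
  have hpow : ∀ m i j, 0 ≤ (W ^ m) i j := by
    intro m
    induction m with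
    | zero =>
      intro i j
      rw [pow_zero, Matrix.one_apply]
      split_ifs <;> norm_num
    | succ m ih =>
      intro i j
      rw [pow_succ, Matrix.mul_apply]
      exact Finset.sum_nonneg fun k _ => mul_nonneg (ih i k) (hW0 k j)
  refine ⟨T, hTS, hT.prop.1, hT.prop.2, fun i hi j hj _ => ?_⟩
  have hmin : T ⊆ T ∩ {k | ∃ m, 1 ≤ m ∧ 0 < (W ^ m) i k} := by
    refine hT.le_of_le ⟨?_, ?_⟩ Set.inter_subset_left
    · obtain ⟨k, -, hk⟩ := Finset.exists_ne_zero_of_sum_ne_zero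
        (show ∑ k, W i k ≠ 0 by rw [hW1]; exact one_ne_zero)
      refine ⟨k, hT.prop.2 i hi k hk, 1, le_rfl, ?_⟩
      rw [pow_one]
      exact (hW0 i k).lt_of_ne' hk
    · rintro k ⟨hkT, m, hm, hmk⟩ l hkl
      refine ⟨hT.prop.2 k hkT l hkl, m + 1, by omega, ?_⟩
      rw [pow_succ, Matrix.mul_apply]
      exact Finset.sum_pos' (fun p _ => mul_nonneg (hpow m i p) (hW0 p l))
        ⟨k, Finset.mem_univ k, mul_pos hmk ((hW0 k l).lt_of_ne' hkl)⟩
  exact (hmin hj).2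

/-- Minimum principle: under Assumption 2, a vector with `Ξ W x ≤ x` is nonnegative. -/
theorem Assumption2.nonneg_of_mul_sum_le {n : ℕ} {W : Matrix (Fin n) (Fin n) ℝ}
    {ξ : Fin n → ℝ} (hA2 : Assumption2 W ξ)
    (hW0 : ∀ i j, 0 ≤ W i j) (hW1 : ∀ i, ∑ j, W i j = 1)
    (hξ : ∀ i, 0 ≤ ξ i ∧ ξ i ≤ 1) {x : Fin n → ℝ}
    (hx : ∀ i, ξ i * ∑ j, W i j * x j ≤ x i) (i : Fin n) : 0 ≤ x i := by
  by_contra! hi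
  obtain ⟨p, -, hp⟩ := Finset.exists_min_image Finset.univ x ⟨i, Finset.mem_univ i⟩
  have hpneg : x p < 0 := (hp i (Finset.mem_univ i)).trans_lt hi
  have hsum : ∀ k, ∑ j, W k j * x j = x p + ∑ j, W k j * (x j - x p) := by
    intro k
    simp only [mul_sub, Finset.sum_sub_distrib, ← Finset.sum_mul, hW1]
    ring
  have hterm : ∀ k j, 0 ≤ W k j * (x j - x p) := fun k j =>
    mul_nonneg (hW0 k j) (sub_nonneg.2 (hp j (Finset.mem_univ j)))
  have hkey : ∀ k, x k = x p → ξ k = 1 ∧ ∑ j, W k j * (x j - x p) = 0 := by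
    intro k hk
    have h := hx k
    rw [hsum, hk] at h
    have h0 : 0 ≤ ∑ j, W k j * (x j - x p) := Finset.sum_nonneg fun j _ => hterm k j
    have h1 : ξ k = 1 := by
      by_contra hne
      have hlt := lt_of_le_of_ne (hξ k).2 hne
      nlinarith [mul_nonneg (hξ k).1 h0]
    rw [h1] at h
    exact ⟨h1, by linarith⟩
  obtain ⟨T, hTS, hT⟩ := exists_isISCC_subset hW0 hW1 (S := {k | x k = x p}) ⟨p, rfl⟩ (by
    intro k hk j hkj
    have h := (Finset.sum_eq_zero_iff_of_nonneg fun j _ => hterm k j).1 (hkey k hk).2 j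
      (Finset.mem_univ j)
    exact sub_eq_zero.1 ((mul_eq_zero.1 h).resolve_left hkj))
  obtain ⟨k, hkT, hk⟩ := hA2 T hT
  exact hk.ne (hkey k (hTS hkT)).1

theorem Matrix.diagonal_mul_mulVec_apply {n : ℕ} (W : Matrix (Fin n) (Fin n) ℝ)
    (ξ x : Fin n → ℝ) (i : Fin n) :
    ((Matrix.diagonal ξ * W) *ᵥ x) i = ξ i * ∑ j, W i j * x j := by
  rw [← Matrix.mulVec_mulVec, Matrix.mulVec_diagonal]
  rfl

/-- Under Assumption 2, `I - Ξ W` is invertible. -/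
theorem Assumption2.isUnit_one_sub {n : ℕ} {W : Matrix (Fin n) (Fin n) ℝ}
    {ξ : Fin n → ℝ} (hA2 : Assumption2 W ξ)
    (hW0 : ∀ i j, 0 ≤ W i j) (hW1 : ∀ i, ∑ j, W i j = 1)
    (hξ : ∀ i, 0 ≤ ξ i ∧ ξ i ≤ 1) : IsUnit (1 - Matrix.diagonal ξ * W) := by
  have hker : ∀ x : Fin n → ℝ, (1 - Matrix.diagonal ξ * W) *ᵥ x = 0 → ∀ i, 0 ≤ x i := by
    intro x hx
    refine hA2.nonneg_of_mul_sum_le hW0 hW1 hξ fun i => ?_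
    have h := congrFun hx i
    rw [Matrix.sub_mulVec, Matrix.one_mulVec, Pi.sub_apply,
      Matrix.diagonal_mul_mulVec_apply, Pi.zero_apply] at h
    linarith
  rw [← Matrix.mulVec_injective_iff_isUnit]
  intro x y hxy
  have h1 : (1 - Matrix.diagonal ξ * W) *ᵥ (x - y) = 0 := by
    rw [Matrix.mulVec_sub]; exact sub_eq_zero.2 hxy
  have h2 : (1 - Matrix.diagonal ξ * W) *ᵥ (y - x) = 0 := by
    rw [Matrix.mulVec_sub]; exact sub_eq_zero.2 hxy.symm
  funext i
  exact le_antisymm (sub_nonneg.1 (hker _ h2 i)) (sub_nonneg.1 (hker _ h1 i))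

/-- Under Assumption 2, for any row-stochastic `H` with positive diagonal and
`Φ = HΨ`: (a) `H i j > 0` implies `Φ i j > 0` for stubborn `j`; (b) for partially
stubborn `i` and stubborn `j ≠ i`, `W i j > 0` implies `Φ i j > 0`. -/
theorem phi_positivity_from_H_and_W
    (n : ℕ) (hn : 1 ≤ n)
    (W Ξ : Matrix (Fin n) (Fin n) ℝ) (ξ : Fin n → ℝ)
    (hW0 : ∀ i j, 0 ≤ W i j) (hW1 : ∀ i, ∑ j, W i j = 1)
    (hΞ : Ξ = Matrix.diagonal ξ) (hξ : ∀ i, 0 ≤ ξ i ∧ ξ i ≤ 1)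
    (hA2 : Assumption2 W ξ)
    (Ψ : Matrix (Fin n) (Fin n) ℝ) (hΨ : Ψ = (1 - Ξ * W)⁻¹ * (1 - Ξ))
    (H : Matrix (Fin n) (Fin n) ℝ)
    (hH0 : ∀ i j, 0 ≤ H i j) (hH1 : ∀ i, ∑ j, H i j = 1)
    (hHd : ∀ i, 0 < H i i)
    (Φ : Matrix (Fin n) (Fin n) ℝ) (hΦ : Φ = H * Ψ) :
    (∀ i j, ξ j < 1 → 0 < H i j → 0 < Φ i j) ∧
    (∀ i j, 0 < ξ i → ξ i < 1 → ξ j < 1 → j ≠ i → 0 < W i j → 0 < Φ i j) := by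
  subst hΞ hΨ hΦ
  have hunit := hA2.isUnit_one_sub hW0 hW1 hξ
  set P := (1 - Matrix.diagonal ξ * W)⁻¹ with hP
  have hPmul : (1 - Matrix.diagonal ξ * W) * P = 1 :=
    Matrix.mul_nonsing_inv _ ((Matrix.isUnit_iff_isUnit_det _).1 hunit)
  have hPapp : ∀ i j, P i j = (1 : Matrix (Fin n) (Fin n) ℝ) i j + ξ i * ∑ k, W i k * P k j := by
    intro i j
    have h := congrFun (congrFun hPmul i) j
    rw [sub_mul, one_mul, Matrix.sub_apply, Matrix.mul_assoc, Matrix.diagonal_mul,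
      Matrix.mul_apply] at h
    linarith
  have hone : ∀ i j, 0 ≤ (1 : Matrix (Fin n) (Fin n) ℝ) i j := by
    intro i j
    rw [Matrix.one_apply]
    split_ifs <;> norm_num
  have hP0 : ∀ i j, 0 ≤ P i j := fun i j =>
    hA2.nonneg_of_mul_sum_le hW0 hW1 hξ (x := fun k => P k j)
      (fun k => by linarith [hPapp k j, hone k j]) i
  have hPdiag : ∀ j, 0 < P j j := by
    intro j
    rw [hPapp, Matrix.one_apply_eq]
    have h := mul_nonneg (hξ j).1
      (Finset.sum_nonneg fun k (_ : k ∈ Finset.univ) => mul_nonneg (hW0 j k) (hP0 k j))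
    linarith
  have hPpos : ∀ i j, 0 < ξ i → 0 < W i j → 0 < P i j := by
    intro i j hi hij
    rw [hPapp]
    exact add_pos_of_nonneg_of_pos (hone i j) (mul_pos hi
      (Finset.sum_pos' (fun k _ => mul_nonneg (hW0 i k) (hP0 k j))
        ⟨j, Finset.mem_univ j, mul_pos hij (hPdiag j)⟩))
  have hΦpos : ∀ i j k, ξ j < 1 → 0 < H i k → 0 < P k j →
      0 < (H * (P * (1 - Matrix.diagonal ξ))) i j := by
    intro i j k hj hik hkj
    rw [← Matrix.diagonal_one, Matrix.diagonal_sub, ← Matrix.mul_assoc, Matrix.mul_diagonal,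
      Matrix.mul_apply]
    exact mul_pos (Finset.sum_pos' (fun l _ => mul_nonneg (hH0 i l) (hP0 l j))
      ⟨k, Finset.mem_univ k, mul_pos hik hkj⟩) (sub_pos.2 hj)
  exact ⟨fun i j hj hij => hΦpos i j j hj hij (hPdiag j),
    fun i j hi _ hj _ hij => hΦpos i j i hj (hHd i) (hPpos i j hi hij)⟩
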